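/- Let x̄ ∈ Ω, suppose the PMFCQ holds at x̄, and assume that the family {g_t}_{t∈T} is uniformly strictly differentiable at x̄. Then the limiting normal cone to Ω at x̄ is computed by N(x̄; Ω) = ⋂_{ε>0} cl* cone{∇g_t(x̄) : t ∈ T_ε(x̄)} + ∇h(x̄)*(Y*); in particular Ω is normally regular at x̄, i.e. N(x̄; Ω) = N̂(x̄; Ω). -/

import Mathlib

open Filter Topology Set Pointwise

section Defs

variable {X : Type*} [NormedAddCommGroup X] [NormedSpace ℝ X]

/-- The canonical identification of the dual of `X` with its weak* dual. -/
def toWD (p : X →L[ℝ] ℝ) : WeakDual ℝ X := p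

/-- The weak* closure of a subset of the dual. -/
def wkClosure (S : Set (X →L[ℝ] ℝ)) : Set (X →L[ℝ] ℝ) :=
  {p | toWD p ∈ closure (toWD '' S)}

/-- A subset of the dual is weak* closed. -/
def IsWeakStarClosed (S : Set (X →L[ℝ] ℝ)) : Prop :=
  IsClosed (toWD '' S)

/-- A subset of `X* × ℝ` is weak* closed. -/
def IsWeakStarClosedProd (S : Set ((X →L[ℝ] ℝ) × ℝ)) : Prop :=
  IsClosed ((fun p : (X →L[ℝ] ℝ) × ℝ => (toWD p.1, p.2)) '' S)

/-- The convex conic hull of `S ∪ {0}`: all finite nonnegative combinations of elements of `S`. -/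
def coneHull {E : Type*} [AddCommMonoid E] [Module ℝ E] (S : Set E) : Set E :=
  {x | ∃ (n : ℕ) (c : Fin n → ℝ) (v : Fin n → E),
    (∀ i, 0 ≤ c i) ∧ (∀ i, v i ∈ S) ∧ x = ∑ i, c i • v i}

/-- The set of ε-normals to `Ω` at `x`. -/
def epsNormal (Ω : Set X) (x : X) (ε : ℝ) : Set (X →L[ℝ] ℝ) :=
  {p | ∀ γ > (0:ℝ), ∃ δ > (0:ℝ), ∀ u ∈ Ω, ‖u - x‖ < δ → p (u - x) ≤ (ε + γ) * ‖u - x‖}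

/-- The Fréchet (regular) normal cone to `Ω` at `x`. -/
def frechetNormal (Ω : Set X) (x : X) : Set (X →L[ℝ] ℝ) := epsNormal Ω x 0

/-- The limiting (Mordukhovich) normal cone to `Ω` at `xb`. -/
def limitingNormal (Ω : Set X) (xb : X) : Set (X →L[ℝ] ℝ) :=
  {p | ∃ (ε : ℕ → ℝ) (xs : ℕ → X) (ps : ℕ → X →L[ℝ] ℝ),
    (∀ n, 0 ≤ ε n) ∧ Tendsto ε atTop (𝓝 0) ∧
    (∀ n, xs n ∈ Ω) ∧ Tendsto xs atTop (𝓝 xb) ∧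
    (∀ n, ps n ∈ epsNormal Ω (xs n) (ε n)) ∧
    (∀ v : X, Tendsto (fun n => ps n v) atTop (𝓝 (p v)))}

/-- The normal cone of convex analysis to `Ω` at `xb`. -/
def convexNormal (Ω : Set X) (xb : X) : Set (X →L[ℝ] ℝ) :=
  {p | ∀ x ∈ Ω, p (x - xb) ≤ 0}

/-- The subdifferential of convex analysis of `f` at `xb`. -/
def convexSubdiff (f : X → ℝ) (xb : X) : Set (X →L[ℝ] ℝ) :=
  {p | ∀ x, f xb + p (x - xb) ≤ f x}

variable {Y : Type*} [NormedAddCommGroup Y] [NormedSpace ℝ Y]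

/-- The image `A*(Y*)` of the adjoint operator `A* : Y* → X*`. -/
def adjRange (A : X →L[ℝ] Y) : Set (X →L[ℝ] ℝ) :=
  Set.range fun q : Y →L[ℝ] ℝ => q.comp A

variable {T : Type*}

/-- Uniform Fréchet differentiability of the family `g = (g t)` at `xb`:
`s(η) := sup_t sup_{x ∈ B_η(xb), x ≠ xb} |g t x - g t xb - ⟨dg t, x - xb⟩|/‖x - xb‖ → 0` as `η ↓ 0`. -/
def UnifFrechetDiffAt (g : T → X → ℝ) (dg : T → X →L[ℝ] ℝ) (xb : X) : Prop :=
  ∀ ε > (0:ℝ), ∃ η > (0:ℝ), ∀ t : T, ∀ x : X, ‖x - xb‖ ≤ η →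
    |g t x - g t xb - dg t (x - xb)| ≤ ε * ‖x - xb‖

/-- Uniform strict differentiability of the family `g = (g t)` at `xb`:
`r(η) := sup_t sup_{x,x' ∈ B_η(xb), x ≠ x'} |g t x - g t x' - ⟨dg t, x - x'⟩|/‖x - x'‖ → 0`
as `η ↓ 0`. -/
def UnifStrictDiffAt (g : T → X → ℝ) (dg : T → X →L[ℝ] ℝ) (xb : X) : Prop :=
  ∀ ε > (0:ℝ), ∃ η > (0:ℝ), ∀ t : T, ∀ x x' : X, ‖x - xb‖ ≤ η → ‖x' - xb‖ ≤ η →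
    |g t x - g t x' - dg t (x - x')| ≤ ε * ‖x - x'‖

/-- The inequality part of the PMFCQ at `xb` with the direction `xt`:
`inf_{ε>0} sup_{t ∈ T_ε(xb)} ⟨dg t, xt⟩ < 0`, where `T_ε(xb) = {t | g t xb ≥ -ε}`. -/
def PMFCQat (g : T → X → ℝ) (dg : T → X →L[ℝ] ℝ) (xb xt : X) : Prop :=
  ∃ ε > (0:ℝ), ∃ δ > (0:ℝ), ∀ t : T, -ε ≤ g t xb → dg t xt ≤ -δ

end Defs

section Aux

variable {X : Type*} [NormedAddCommGroup X] [NormedSpace ℝ X]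
variable {Y : Type*} [NormedAddCommGroup Y] [NormedSpace ℝ Y]

theorem aux_lyusternik [CompleteSpace X] [CompleteSpace Y] {h : X → Y} {dh : X →L[ℝ] Y} {xb : X}
    (hhd : HasStrictFDerivAt h dh xb) (hsurj : Function.Surjective dh) :
    ∃ κ > (0:ℝ), ∀ ρ > (0:ℝ), ∃ η > (0:ℝ), ∀ x v : X, ‖x - xb‖ ≤ η → ‖v‖ ≤ η → h x = 0 →
      dh v = 0 → ∃ u, h u = 0 ∧ ‖u - (x + v)‖ ≤ κ * ρ * ‖v‖ := by
  have hr : (dh : X →ₗ[ℝ] Y).range = ⊤ := LinearMap.range_eq_top.2 hsurj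
  obtain ⟨f, hf⟩ : ∃ f : dh.NonlinearRightInverse, 0 < f.nnnorm :=
    ⟨_, ContinuousLinearMap.nonlinearRightInverseOfSurjective_nnnorm_pos dh hr⟩
  have hN : (0:ℝ) < f.nnnorm := by exact_mod_cast hf
  generalize hNN : (f.nnnorm : ℝ) = N at hN
  refine ⟨2 * N, by positivity, fun ρ hρ => ?_⟩
  obtain ⟨c, hc, hc1, hc2⟩ : ∃ c : ℝ, 0 < c ∧ c ≤ ρ ∧ c ≤ 1 / (2 * N) :=
    ⟨min ρ (1 / (2 * N)), lt_min hρ (by positivity), min_le_left _ _, min_le_right _ _⟩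
  lift c to NNReal using hc.le
  obtain ⟨s, hs, hA⟩ := hhd.approximates_deriv_on_nhds (c := c) (Or.inr (by exact_mod_cast hc))
  obtain ⟨R, hR, hRs⟩ := Metric.mem_nhds_iff.1 hs
  refine ⟨R / 4, by positivity, fun x v hx hv hhx hdv => ?_⟩
  have hNc : 2 * N * c ≤ 1 := by
    rw [le_div_iff₀ (by positivity)] at hc2; linarith
  have hxs : x ∈ s := hRs (by rw [Metric.mem_ball, dist_eq_norm]; linarith)
  have hxv : ‖x + v - xb‖ ≤ R / 2 := by
    have : x + v - xb = (x - xb) + v := by abel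
    rw [this]; exact (norm_add_le _ _).trans (by linarith)
  have hxvs : x + v ∈ s := hRs (by rw [Metric.mem_ball, dist_eq_norm]; linarith)
  have h1 := hA (x + v) hxvs x hxs
  simp only [add_sub_cancel_left, hdv, hhx, sub_zero] at h1
  have hv0 := norm_nonneg v
  have hε : 0 ≤ 2 * N * c * ‖v‖ := by positivity
  have hε1 : 2 * N * c * ‖v‖ ≤ ‖v‖ := by nlinarith
  have hsub : Metric.closedBall (x + v) (2 * N * c * ‖v‖) ⊆ s := by
    intro z hz
    apply hRs
    rw [Metric.mem_closedBall, dist_eq_norm] at hz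
    rw [Metric.mem_ball, dist_eq_norm]
    have : z - xb = (z - (x + v)) + (x + v - xb) := by abel
    rw [this]
    exact (norm_add_le _ _).trans_lt (by linarith)
  have hS := hA.surjOn_closedBall_of_nonlinearRightInverse f hε hsub
  have hmem : (0 : Y) ∈ Metric.closedBall (h (x + v)) (((f.nnnorm : ℝ)⁻¹ - c) * (2 * N * c * ‖v‖)) := by
    rw [Metric.mem_closedBall, dist_eq_norm, zero_sub, norm_neg, hNN]
    refine h1.trans ?_
    have : (N⁻¹ - c) * (2 * N * c * ‖v‖) = (2 - 2 * N * c) * (c * ‖v‖) := by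
      field_simp
    rw [this]
    nlinarith [mul_nonneg hc.le hv0]
  obtain ⟨u, hu, hu0⟩ := hS hmem
  refine ⟨u, hu0, ?_⟩
  rw [Metric.mem_closedBall, dist_eq_norm] at hu
  refine hu.trans ?_
  gcongr

theorem aux_range [CompleteSpace X] [CompleteSpace Y] {dh : X →L[ℝ] Y}
    (hsurj : Function.Surjective dh) (p : X →L[ℝ] ℝ) (hp : ∀ v, dh v = 0 → p v = 0) :
    p ∈ adjRange dh := by
  obtain ⟨C, hC, hpre⟩ := dh.exists_preimage_norm_le hsurj
  choose f hf hfn using hpre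
  have key : ∀ x y, dh x = dh y → p x = p y := by
    intro x y hxy
    have := hp (x - y) (by rw [map_sub, hxy, sub_self])
    rw [map_sub] at this; linarith
  let q : Y →ₗ[ℝ] ℝ :=
    { toFun := fun y => p (f y)
      map_add' := fun a b => by
        rw [← map_add]; apply key; rw [map_add, hf, hf, hf]
      map_smul' := fun c a => by
        rw [RingHom.id_apply, ← map_smul]; apply key; rw [map_smul, hf, hf] }
  refine ⟨q.mkContinuous (‖p‖ * C) (fun y => ?_), ?_⟩
  · refine (p.le_opNorm _).trans ?_
    rw [mul_assoc]
    exact mul_le_mul_of_nonneg_left (hfn y) (norm_nonneg _)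
  · ext x
    exact key _ _ (hf _)

theorem aux_mem_toWD {S : Set (X →L[ℝ] ℝ)} {p : X →L[ℝ] ℝ} : toWD p ∈ toWD '' S ↔ p ∈ S :=
  ⟨fun ⟨q, hq, he⟩ => by
    have : q = p := he
    exact this ▸ hq, fun hp => ⟨p, hp, rfl⟩⟩

theorem aux_sep {A : Set (X →L[ℝ] ℝ)} (h0 : (0 : X →L[ℝ] ℝ) ∈ A)
    (hadd : ∀ a ∈ A, ∀ b ∈ A, a + b ∈ A) (hsmul : ∀ c : ℝ, 0 ≤ c → ∀ a ∈ A, c • a ∈ A)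
    (p : X →L[ℝ] ℝ) (hp : ∀ v, (∀ a ∈ A, a v ≤ 0) → p v ≤ 0) : p ∈ wkClosure A := by
  by_contra hcon
  have hconv : Convex ℝ (toWD '' A) := by
    rintro _ ⟨a, ha, rfl⟩ _ ⟨b, hb, rfl⟩ s t hs ht _
    exact ⟨s • a + t • b, hadd _ (hsmul s hs a ha) _ (hsmul t ht b hb), rfl⟩
  haveI : LocallyConvexSpace ℝ (WeakDual ℝ X) :=
    inferInstanceAs (LocallyConvexSpace ℝ (WeakBilin _))
  obtain ⟨f, u, hf, hu⟩ := geometric_hahn_banach_closed_point (x := toWD p) hconv.closure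
    isClosed_closure hcon
  obtain ⟨v, hv⟩ : ∃ v : X, ∀ a : X →L[ℝ] ℝ, f (toWD a) = a v := by
    obtain ⟨v, hv⟩ := LinearMap.dualEmbedding_surjective (topDualPairing ℝ X) f
    refine ⟨v, fun a => ?_⟩
    rw [← hv]; rfl
  have hA : ∀ a ∈ A, a v < u := fun a ha => by
    rw [← hv]; exact hf _ (subset_closure ⟨a, ha, rfl⟩)
  have hu0 : 0 < u := by simpa using hA 0 h0
  have hle : ∀ a ∈ A, a v ≤ 0 := by
    intro a ha
    by_contra hpos
    push Not at hpos
    have := hA _ (hsmul (u / a v) (by positivity) a ha)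
    simp only [ContinuousLinearMap.smul_apply, smul_eq_mul] at this
    rw [div_mul_cancel₀ _ hpos.ne'] at this
    exact lt_irrefl _ this
  have := hp v hle
  rw [hv] at hu
  linarith

theorem aux_cone_zero (S : Set (X →L[ℝ] ℝ)) : (0 : X →L[ℝ] ℝ) ∈ coneHull S :=
  ⟨0, 0, 0, fun i => i.elim0, fun i => i.elim0, by simp⟩

theorem aux_cone_mem {S : Set (X →L[ℝ] ℝ)} {s : X →L[ℝ] ℝ} (hs : s ∈ S) : s ∈ coneHull S :=
  ⟨1, fun _ => 1, fun _ => s, by simp, by simpa using hs, by simp⟩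

theorem aux_cone_add {S : Set (X →L[ℝ] ℝ)} {a b : X →L[ℝ] ℝ} (ha : a ∈ coneHull S)
    (hb : b ∈ coneHull S) : a + b ∈ coneHull S := by
  obtain ⟨n, c, v, hc, hv, rfl⟩ := ha
  obtain ⟨m, d, w, hd, hw, rfl⟩ := hb
  refine ⟨n + m, Fin.append c d, Fin.append v w, fun i => ?_, fun i => ?_, ?_⟩
  · refine Fin.addCases (fun i => ?_) (fun i => ?_) i
    · simpa using hc i
    · simpa using hd i
  · refine Fin.addCases (fun i => ?_) (fun i => ?_) i
    · simpa using hv i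
    · simpa using hw i
  · simp [Fin.sum_univ_add]

theorem aux_cone_smul {S : Set (X →L[ℝ] ℝ)} {a : X →L[ℝ] ℝ} (r : ℝ) (hr : 0 ≤ r)
    (ha : a ∈ coneHull S) : r • a ∈ coneHull S := by
  obtain ⟨n, c, v, hc, hv, rfl⟩ := ha
  refine ⟨n, fun i => r * c i, v, fun i => mul_nonneg hr (hc i), hv, ?_⟩
  simp [Finset.smul_sum, mul_smul]

theorem aux_cone_mono {S S' : Set (X →L[ℝ] ℝ)} (hS : S ⊆ S') : coneHull S ⊆ coneHull S' := by
  rintro _ ⟨n, c, v, hc, hv, rfl⟩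
  exact ⟨n, c, v, hc, fun i => hS (hv i), rfl⟩

theorem aux_cone_le {S : Set (X →L[ℝ] ℝ)} {w : X} (hw : ∀ s ∈ S, s w ≤ 0) {a : X →L[ℝ] ℝ}
    (ha : a ∈ coneHull S) : a w ≤ 0 := by
  obtain ⟨n, c, v, hc, hv, rfl⟩ := ha
  simp only [ContinuousLinearMap.sum_apply, ContinuousLinearMap.smul_apply, smul_eq_mul]
  exact Finset.sum_nonpos fun i _ => mul_nonpos_of_nonneg_of_nonpos (hc i) (hw _ (hv i))

theorem aux_wk_le {A : Set (X →L[ℝ] ℝ)} {w : X} (hw : ∀ s ∈ A, s w ≤ 0) {a : X →L[ℝ] ℝ}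
    (ha : a ∈ wkClosure A) : a w ≤ 0 := by
  have hcl : IsClosed {q : WeakDual ℝ X | q w ≤ 0} :=
    isClosed_le (WeakDual.eval_continuous w) continuous_const
  have : toWD '' A ⊆ {q : WeakDual ℝ X | q w ≤ 0} := by
    rintro _ ⟨s, hs, rfl⟩
    exact hw s hs
  exact closure_minimal this hcl ha

theorem aux_wk_mono {S S' : Set (X →L[ℝ] ℝ)} (hS : S ⊆ S') : wkClosure S ⊆ wkClosure S' :=
  fun p (ha : toWD p ∈ closure (toWD '' S)) =>
    (closure_mono (image_mono hS) ha : toWD p ∈ closure (toWD '' S'))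

theorem aux_compact (A : ℕ → Set (X →L[ℝ] ℝ)) (hanti : ∀ n, A (n + 1) ⊆ A n)
    (L : Set (X →L[ℝ] ℝ)) (hL : IsClosed (toWD '' L)) (xt : X) (R0 : ℝ) (hR0 : 0 ≤ R0)
    (hA : ∀ n, ∀ a ∈ A n, ‖a‖ ≤ R0 * (-a xt)) (hLx : ∀ l ∈ L, l xt = 0) (p : X →L[ℝ] ℝ)
    (hp : ∀ n, p ∈ wkClosure (A n + L)) : ∃ a, (∀ n, a ∈ wkClosure (A n)) ∧ p - a ∈ L := by
  let R := R0 * (1 - p xt)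
  let K : ℕ → Set (X →L[ℝ] ℝ) := fun n => A n ∩ {a | ‖a‖ ≤ R}
  have hball : IsCompact (WeakDual.toStrongDual ⁻¹' Metric.closedBall (0 : StrongDual ℝ X) R :
      Set (WeakDual ℝ X)) := WeakDual.isCompact_closedBall 0 R
  have hKc : ∀ n, IsCompact (closure (toWD '' K n)) := by
    intro n
    refine hball.of_isClosed_subset isClosed_closure (closure_minimal ?_ hball.isClosed)
    rintro _ ⟨a, ha, rfl⟩
    have h2 : ‖a‖ ≤ R := ha.2
    rw [mem_preimage, mem_closedBall_zero_iff]
    exact h2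
  let U : Set (WeakDual ℝ X) := {q | p xt - 1 < q xt}
  have hU : IsOpen U := isOpen_lt continuous_const (WeakDual.eval_continuous xt)
  have hdec : ∀ n, toWD p ∈ closure (toWD '' K n) + toWD '' L := by
    intro n
    have h1 : toWD p ∈ closure (U ∩ toWD '' (A n + L)) :=
      hU.inter_closure ⟨show p xt - 1 < p xt by linarith, hp n⟩
    refine closure_minimal ?_ (IsClosed.add_left_of_isCompact hL (hKc n)) h1
    rintro _ ⟨hq, _, ⟨a, ha, l, hl, rfl⟩, rfl⟩
    refine ⟨toWD a, subset_closure ⟨a, ⟨ha, ?_⟩, rfl⟩, toWD l, ⟨l, hl, rfl⟩, rfl⟩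
    have hq' : p xt - 1 < a xt + l xt := hq
    rw [hLx l hl] at hq'
    refine (hA n a ha).trans ?_
    exact mul_le_mul_of_nonneg_left (by linarith) hR0
  let F : ℕ → Set (WeakDual ℝ X) := fun n =>
    closure (toWD '' K n) ∩ (fun a => toWD p - a) ⁻¹' (toWD '' L)
  have hFcl : IsClosed ((fun a : WeakDual ℝ X => toWD p - a) ⁻¹' (toWD '' L)) :=
    hL.preimage (continuous_const.sub continuous_id)
  obtain ⟨a, ha⟩ := IsCompact.nonempty_iInter_of_sequence_nonempty_isCompact_isClosed F
    (fun n => inter_subset_inter_left _ (closure_mono (image_mono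
      (inter_subset_inter_left _ (hanti n)))))
    (fun n => by
      obtain ⟨a, ha, l, hl, hal⟩ := hdec n
      refine ⟨a, ha, ?_⟩
      have : toWD p - a = l := by rw [← hal]; simp
      rw [mem_preimage, this]; exact hl)
    ((hKc 0).inter_right hFcl) (fun n => isClosed_closure.inter hFcl)
  rw [mem_iInter] at ha
  refine ⟨WeakDual.toStrongDual a, fun n => ?_, ?_⟩
  · have h3 : a ∈ closure (toWD '' A n) := closure_mono (image_mono inter_subset_left) (ha n).1
    exact h3
  · exact aux_mem_toWD.1 (ha 0).2

variable {T : Type*}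

theorem aux_key [CompleteSpace X] [CompleteSpace Y]
    (g : T → X → ℝ) (dg : T → X →L[ℝ] ℝ) (h : X → Y) (dh : X →L[ℝ] Y) (xb : X)
    (hhd : HasStrictFDerivAt h dh xb)
    (M : ℝ) (hM : ∀ t : T, ‖dg t‖ ≤ M) (hM0 : 0 ≤ M)
    (hsurj : Function.Surjective dh)
    (hunif : UnifStrictDiffAt g dg xb) (p : X →L[ℝ] ℝ)
    (hp : p ∈ limitingNormal {x : X | h x = 0 ∧ ∀ t : T, g t x ≤ 0} xb)
    (v : X) (hv : dh v = 0) (e σ : ℝ) (he : 0 < e) (hσ : 0 < σ)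
    (hgv : ∀ t, -e ≤ g t xb → dg t v ≤ -σ) : p v ≤ 0 := by
  obtain ⟨ε, xs, ps, hε0, hε, hxs, hxt, hps, hpt⟩ := hp
  obtain ⟨κ, hκ, hlyu⟩ := aux_lyusternik hhd hsurj
  obtain ⟨B, hB⟩ : ∃ B, ∀ n, ‖ps n‖ ≤ B := by
    apply banach_steinhaus
    intro x
    obtain ⟨C, hC⟩ := (hpt x).norm.bddAbove_range
    exact ⟨C, fun n => hC ⟨n, rfl⟩⟩
  have hB0 : 0 ≤ B := (norm_nonneg _).trans (hB 0)
  have hv0 := norm_nonneg v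
  -- the main estimate
  have main : ∀ ρ > (0:ℝ), κ * ρ ≤ 1 → M * (κ * ρ * ‖v‖) + ρ * (2 * ‖v‖) ≤ σ →
      p v ≤ B * (κ * ρ * ‖v‖) + ρ * (2 * ‖v‖) := by
    intro ρ hρ hρ1 hρ2
    obtain ⟨η1, hη1, hl⟩ := hlyu ρ hρ
    obtain ⟨η2, hη2, hu⟩ := hunif ρ hρ
    -- radius
    obtain ⟨η, hη, hηa, hηb, hηc⟩ : ∃ η > (0:ℝ), η ≤ η1 ∧ η ≤ η2 ∧ (M + ρ) * η ≤ e :=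
      ⟨min η1 (min η2 (e / (M + ρ))), by positivity, min_le_left _ _,
        (min_le_right _ _).trans (min_le_left _ _), by
          have : min η1 (min η2 (e / (M + ρ))) ≤ e / (M + ρ) :=
            (min_le_right _ _).trans (min_le_right _ _)
          rw [le_div_iff₀ (by positivity)] at this; linarith⟩
    have hev : ∀ᶠ n in atTop, ps n v ≤ B * (κ * ρ * ‖v‖) + (ε n + ρ / 2) * (2 * ‖v‖) := by
      have hn : ∀ᶠ n in atTop, ‖xs n - xb‖ < η / 2 := by
        have := Metric.tendsto_nhds.1 hxt (η / 2) (by positivity)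
        simpa [dist_eq_norm] using this
      filter_upwards [hn] with n hn
      obtain ⟨d, hd, hnorm⟩ := hps n (ρ / 2) (by positivity)
      obtain ⟨τ, hτ, hτ1, hτ2⟩ : ∃ τ > (0:ℝ), τ * (2 * ‖v‖) < d ∧ τ * (2 * ‖v‖) ≤ η / 2 := by
        refine ⟨min (d / 2) (η / 2) / (2 * ‖v‖ + 1), by positivity, ?_, ?_⟩
        · have : min (d / 2) (η / 2) / (2 * ‖v‖ + 1) * (2 * ‖v‖ + 1) = min (d / 2) (η / 2) := by
            field_simp
          have h2 : 0 < min (d / 2) (η / 2) / (2 * ‖v‖ + 1) := by positivity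
          have := min_le_left (d / 2) (η / 2)
          nlinarith
        · have : min (d / 2) (η / 2) / (2 * ‖v‖ + 1) * (2 * ‖v‖ + 1) = min (d / 2) (η / 2) := by
            field_simp
          have h2 : 0 < min (d / 2) (η / 2) / (2 * ‖v‖ + 1) := by positivity
          have := min_le_right (d / 2) (η / 2)
          nlinarith
      have hτv : ‖τ • v‖ = τ * ‖v‖ := by rw [norm_smul, Real.norm_of_nonneg hτ.le]
      have hτv0 : 0 ≤ τ * ‖v‖ := by positivity
      obtain ⟨u, hu0, hun⟩ := hl (xs n) (τ • v) (by linarith) (by rw [hτv]; linarith) (hxs n).1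
        (by rw [map_smul, hv, smul_zero])
      rw [hτv] at hun
      have hw : u - xs n = τ • v + (u - (xs n + τ • v)) := by abel
      generalize u - (xs n + τ • v) = w at hun hw
      have hux : ‖u - xs n‖ ≤ τ * (2 * ‖v‖) := by
        rw [hw]; refine (norm_add_le _ _).trans ?_; rw [hτv]; nlinarith
      have hub : ‖u - xb‖ ≤ η := by
        have : u - xb = (u - xs n) + (xs n - xb) := by abel
        rw [this]; refine (norm_add_le _ _).trans ?_; linarith
      have huΩ : ∀ t, g t u ≤ 0 := by
        intro t
        by_cases ht : -e ≤ g t xb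
        · have h1 := (abs_le.1 (hu t u (xs n) (by linarith) (by linarith))).2
          have h2 := (hxs n).2 t
          have h3 : dg t (u - xs n) ≤ τ * (-σ) + M * (κ * ρ * (τ * ‖v‖)) := by
            rw [hw, map_add, map_smul, smul_eq_mul]
            have h4 := hgv t ht
            have h5 : dg t w ≤ M * (κ * ρ * (τ * ‖v‖)) :=
              (le_abs_self _).trans (((dg t).le_opNorm w).trans
                (mul_le_mul (hM t) hun (norm_nonneg _) hM0))
            nlinarith
          have h6 : ρ * ‖u - xs n‖ ≤ ρ * (τ * (2 * ‖v‖)) := by gcongr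
          have h7 := mul_le_mul_of_nonneg_left hρ2 hτ.le
          nlinarith
        · push Not at ht
          have h1 := (abs_le.1 (hu t u xb (by linarith) (by simpa using hη2.le))).2
          have h5 : dg t (u - xb) ≤ M * ‖u - xb‖ :=
              (le_abs_self _).trans ((dg t).le_of_opNorm_le (hM t) _)
          have : (M + ρ) * ‖u - xb‖ ≤ (M + ρ) * η := by gcongr
          linarith
      have hfin := hnorm u ⟨hu0, huΩ⟩ (by linarith)
      have h8 : (ε n + ρ / 2) * ‖u - xs n‖ ≤ (ε n + ρ / 2) * (τ * (2 * ‖v‖)) := by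
        have := hε0 n
        gcongr
      rw [hw, map_add, map_smul, smul_eq_mul, ← hw] at hfin
      have h9 : -(B * (κ * ρ * (τ * ‖v‖))) ≤ ps n w := by
        have := (abs_le.1 (((ps n).le_opNorm w).trans
          (mul_le_mul (hB n) hun (norm_nonneg _) hB0))).1
        exact this
      have h10 : τ * ps n v ≤ τ * (B * (κ * ρ * ‖v‖) + (ε n + ρ / 2) * (2 * ‖v‖)) := by
        linarith
      exact le_of_mul_le_mul_left h10 hτ
    have hlim : Tendsto (fun n => B * (κ * ρ * ‖v‖) + (ε n + ρ / 2) * (2 * ‖v‖)) atTop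
        (𝓝 (B * (κ * ρ * ‖v‖) + (0 + ρ / 2) * (2 * ‖v‖))) :=
      tendsto_const_nhds.add ((hε.add tendsto_const_nhds).mul tendsto_const_nhds)
    have := le_of_tendsto_of_tendsto (hpt v) hlim hev
    nlinarith [mul_nonneg hρ.le hv0]
  have t1 : Tendsto (fun ρ : ℝ => κ * ρ) (𝓝[>] 0) (𝓝 0) := by
    have : ContinuousAt (fun ρ : ℝ => κ * ρ) 0 := by fun_prop
    simpa using this.tendsto.mono_left nhdsWithin_le_nhds
  have t2 : Tendsto (fun ρ : ℝ => M * (κ * ρ * ‖v‖) + ρ * (2 * ‖v‖)) (𝓝[>] 0) (𝓝 0) := by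
    have : ContinuousAt (fun ρ : ℝ => M * (κ * ρ * ‖v‖) + ρ * (2 * ‖v‖)) 0 := by fun_prop
    simpa using this.tendsto.mono_left nhdsWithin_le_nhds
  have t3 : Tendsto (fun ρ : ℝ => B * (κ * ρ * ‖v‖) + ρ * (2 * ‖v‖)) (𝓝[>] 0) (𝓝 0) := by
    have : ContinuousAt (fun ρ : ℝ => B * (κ * ρ * ‖v‖) + ρ * (2 * ‖v‖)) 0 := by fun_prop
    simpa using this.tendsto.mono_left nhdsWithin_le_nhds
  refine ge_of_tendsto t3 ?_
  filter_upwards [self_mem_nhdsWithin, t1.eventually_le_const one_pos, t2.eventually_le_const hσ]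
    with ρ h1 h2 h3
  exact main ρ h1 h2 h3

end Aux

/-- Under the standing assumptions, the PMFCQ at `xb`, and the uniform strict
differentiability of `{g t}` at `xb`, the limiting normal cone to the feasible set
`Ω = {x | h x = 0, g t x ≤ 0 ∀ t}` at `xb` equals
`⋂_{ε>0} cl* cone{dg t : t ∈ T_ε(xb)} + ∇h(xb)*(Y*)`; in particular `Ω` is normally regular
at `xb`, i.e. the limiting and Fréchet normal cones coincide there. -/
theorem statement8 {X Y T : Type*} [NormedAddCommGroup X] [NormedSpace ℝ X] [CompleteSpace X]
    [NormedAddCommGroup Y] [NormedSpace ℝ Y] [CompleteSpace Y]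
    (g : T → X → ℝ) (dg : T → X →L[ℝ] ℝ) (h : X → Y) (dh : X →L[ℝ] Y) (xb : X)
    (hgd : ∀ t : T, HasFDerivAt (g t) (dg t) xb)
    (hhd : HasStrictFDerivAt h dh xb)
    (hbd : ∃ M : ℝ, ∀ t : T, ‖dg t‖ ≤ M)
    (hxb : xb ∈ {x : X | h x = 0 ∧ ∀ t : T, g t x ≤ 0})
    (hsurj : Function.Surjective dh)
    (hpmfcq : ∃ xt : X, dh xt = 0 ∧ PMFCQat g dg xb xt)
    (hunif : UnifStrictDiffAt g dg xb) :
    limitingNormal {x : X | h x = 0 ∧ ∀ t : T, g t x ≤ 0} xb =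
        (⋂ ε > (0:ℝ), wkClosure (coneHull (dg '' {t : T | -ε ≤ g t xb}))) + adjRange dh ∧
      limitingNormal {x : X | h x = 0 ∧ ∀ t : T, g t x ≤ 0} xb =
        frechetNormal {x : X | h x = 0 ∧ ∀ t : T, g t x ≤ 0} xb := by
  obtain ⟨M, hM⟩ : ∃ M : ℝ, 0 ≤ M ∧ ∀ t : T, ‖dg t‖ ≤ M := by
    obtain ⟨M, hM⟩ := hbd
    exact ⟨max M 0, le_max_right _ _, fun t => (hM t).trans (le_max_left _ _)⟩
  obtain ⟨hM0, hM⟩ := hM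
  obtain ⟨xt, hxt, ε0, hε0, δ, hδ, hpm⟩ := hpmfcq
  -- the limiting cone is contained in the right-hand side
  have hA : limitingNormal {x : X | h x = 0 ∧ ∀ t : T, g t x ≤ 0} xb ⊆
      (⋂ ε > (0:ℝ), wkClosure (coneHull (dg '' {t : T | -ε ≤ g t xb}))) + adjRange dh := by
    intro p hp
    have hL0 : (0 : X →L[ℝ] ℝ) ∈ adjRange dh := ⟨0, by simp⟩
    have hcl : IsClosed (toWD '' adjRange dh) := by
      have : toWD '' adjRange dh = ⋂ v : {v : X // dh v = 0}, {q : WeakDual ℝ X | q v.1 = 0} := by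
        ext q
        simp only [mem_iInter, mem_setOf_eq]
        constructor
        · rintro ⟨_, ⟨r, rfl⟩, rfl⟩ v
          show r (dh v.1) = 0
          rw [v.2, map_zero]
        · intro hq
          exact ⟨WeakDual.toStrongDual q, aux_range hsurj _ (fun v hv => hq ⟨v, hv⟩), rfl⟩
      rw [this]
      exact isClosed_iInter fun v => isClosed_eq (WeakDual.eval_continuous _) continuous_const
    have hcone : ∀ ε, 0 < ε → p ∈ wkClosure (coneHull (dg '' {t : T | -ε ≤ g t xb}) + adjRange dh) := by
      intro ε hε
      apply aux_sep
      · exact ⟨0, aux_cone_zero _, 0, hL0, by simp⟩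
      · rintro _ ⟨a, ha, _, ⟨q, rfl⟩, rfl⟩ _ ⟨b, hb, _, ⟨r, rfl⟩, rfl⟩
        refine ⟨a + b, aux_cone_add ha hb, _, ⟨q + r, rfl⟩, ?_⟩
        ext x; simp; ring
      · rintro c hc _ ⟨a, ha, _, ⟨q, rfl⟩, rfl⟩
        refine ⟨c • a, aux_cone_smul c hc ha, _, ⟨c • q, rfl⟩, ?_⟩
        ext x; simp
      · intro v hv
        have hdv : dh v = 0 := by
          apply NormedSpace.eq_zero_of_forall_dual_eq_zero ℝ
          intro q
          have h1 := hv _ ⟨0, aux_cone_zero _, _, ⟨q, rfl⟩, rfl⟩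
          have h2 := hv _ ⟨0, aux_cone_zero _, _, ⟨-q, rfl⟩, rfl⟩
          simp at h1 h2
          linarith
        have hgv : ∀ t, -ε ≤ g t xb → dg t v ≤ 0 := by
          intro t ht
          have := hv _ ⟨dg t, aux_cone_mem ⟨t, ht, rfl⟩, 0, hL0, rfl⟩
          simpa using this
        have hs : ∀ s > (0:ℝ), p v + s * p xt ≤ 0 := by
          intro s hs
          have := aux_key g dg h dh xb hhd M hM hM0 hsurj hunif p hp (v + s • xt)
            (by simp [hdv, hxt]) (min ε ε0) (s * δ) (lt_min hε hε0) (by positivity) (by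
              intro t ht
              have h1 := hgv t (by linarith [min_le_left ε ε0])
              have h2 := hpm t (by linarith [min_le_right ε ε0])
              simp only [map_add, map_smul, smul_eq_mul]
              nlinarith)
          simpa using this
        have t1 : Tendsto (fun s : ℝ => p v + s * p xt) (𝓝[>] 0) (𝓝 (p v)) := by
          have : ContinuousAt (fun s : ℝ => p v + s * p xt) 0 := by fun_prop
          simpa using this.tendsto.mono_left nhdsWithin_le_nhds
        exact le_of_tendsto t1 (by filter_upwards [self_mem_nhdsWithin] with s h using hs s h)
    obtain ⟨a, ha, hl⟩ := aux_compact
      (fun n : ℕ => coneHull (dg '' {t : T | -(ε0 / (n + 1)) ≤ g t xb}))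
      (fun n => aux_cone_mono (image_mono (fun t ht => by
        simp only [mem_setOf_eq] at ht ⊢
        refine le_trans (neg_le_neg ?_) ht
        push_cast
        gcongr
        linarith)))
      (adjRange dh) hcl xt (M / δ) (by positivity)
      (fun n a ha => by
        have hle : ∀ w : X, a w ≤ M / δ * (-a xt) * ‖w‖ := by
          intro w
          have := aux_cone_le (w := w + (M * ‖w‖ / δ) • xt) (by
            rintro _ ⟨t, ht, rfl⟩
            have h1 : dg t w ≤ M * ‖w‖ := (le_abs_self _).trans ((dg t).le_of_opNorm_le (hM t) _)
            have h2 := hpm t (by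
              have h3 : ε0 / (n + 1) ≤ ε0 := div_le_self hε0.le (by linarith [n.cast_nonneg (α := ℝ)])
              have : -(ε0 / (n + 1)) ≤ g t xb := ht
              linarith)
            simp only [map_add, map_smul, smul_eq_mul]
            have h4 : 0 ≤ M * ‖w‖ / δ := by positivity
            have h5 : M * ‖w‖ / δ * (-δ) = - (M * ‖w‖) := by field_simp
            nlinarith [mul_le_mul_of_nonneg_left h2 h4]) ha
          simp only [map_add, map_smul, smul_eq_mul] at this
          have h6 : M / δ * (-a xt) * ‖w‖ = - (M * ‖w‖ / δ * a xt) := by field_simp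
          linarith
        have h0 : a xt ≤ 0 := aux_cone_le (w := xt) (by
            rintro _ ⟨t, ht, rfl⟩
            have h2 := hpm t (by
              have h3 : ε0 / (n + 1) ≤ ε0 := div_le_self hε0.le (by linarith [n.cast_nonneg (α := ℝ)])
              have : -(ε0 / (n + 1)) ≤ g t xb := ht
              linarith)
            linarith) ha
        refine a.opNorm_le_bound (mul_nonneg (by positivity) (by linarith)) (fun w => ?_)
        rw [Real.norm_eq_abs, abs_le]
        refine ⟨?_, hle w⟩
        have := hle (-w)
        rw [map_neg, norm_neg] at this
        linarith)
      (by rintro _ ⟨q, rfl⟩; simp [hxt]) p (fun n => hcone _ (by positivity))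
    refine ⟨a, ?_, p - a, hl, by simp⟩
    simp only [mem_iInter]
    intro ε hε
    obtain ⟨n, hn⟩ := exists_nat_gt (ε0 / ε)
    refine aux_wk_mono (aux_cone_mono (image_mono (fun t ht => ?_))) (ha n)
    simp only [mem_setOf_eq] at ht ⊢
    refine le_trans (neg_le_neg ?_) ht
    rw [div_lt_iff₀ hε] at hn
    rw [div_le_iff₀ (by positivity)]
    nlinarith
  -- the right-hand side is contained in the Frechet cone
  have hB : (⋂ ε > (0:ℝ), wkClosure (coneHull (dg '' {t : T | -ε ≤ g t xb}))) + adjRange dh ⊆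
      frechetNormal {x : X | h x = 0 ∧ ∀ t : T, g t x ≤ 0} xb := by
    rintro _ ⟨a, ha, _, ⟨q, rfl⟩, rfl⟩ γ hγ
    simp only [mem_iInter] at ha
    obtain ⟨r, hr, hrC⟩ : ∃ r > (0:ℝ), 2 * r / δ * |a xt| ≤ γ / 2 := by
      refine ⟨γ * δ / (4 * (|a xt| + 1)), by positivity, ?_⟩
      rw [show 2 * (γ * δ / (4 * (|a xt| + 1))) / δ * |a xt| = γ / 2 * (|a xt| / (|a xt| + 1)) by
        field_simp; ring]
      have : |a xt| / (|a xt| + 1) ≤ 1 := by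
        rw [div_le_one (by positivity)]; linarith
      nlinarith
    obtain ⟨η, hη, hu⟩ := hunif r hr
    obtain ⟨c, hc, hqc⟩ : ∃ c > (0:ℝ), ‖q‖ * c ≤ γ / 2 := by
      refine ⟨γ / 2 / (‖q‖ + 1), by positivity, ?_⟩
      rw [mul_div_assoc', div_le_iff₀ (by positivity)]
      nlinarith [norm_nonneg q]
    have hh := (hhd.hasFDerivAt.isLittleO.def hc)
    obtain ⟨η', hη', hh'⟩ := Metric.eventually_nhds_iff.1 hh
    refine ⟨min η η', lt_min hη hη', fun u huΩ hun => ?_⟩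
    have hn1 : ‖u - xb‖ ≤ η := hun.le.trans (min_le_left _ _)
    have hn2 := hh' (y := u) (by rw [dist_eq_norm]; exact hun.trans_le (min_le_right _ _))
    rw [huΩ.1, hxb.1, sub_zero, zero_sub, norm_neg] at hn2
    rcases eq_or_ne u xb with rfl | hne
    · simp
    have hpos : 0 < ‖u - xb‖ := norm_pos_iff.2 (sub_ne_zero.2 hne)
    have hrp : 0 < r * ‖u - xb‖ := by positivity
    have h1 := aux_wk_le (w := (u - xb) + (2 * r * ‖u - xb‖ / δ) • xt) (fun s hs =>
      aux_cone_le (by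
        rintro _ ⟨t, ht, rfl⟩
        have ht' : -(min ε0 (r * ‖u - xb‖)) ≤ g t xb := ht
        have h2 := hpm t (by linarith [min_le_left ε0 (r * ‖u - xb‖)])
        have h3 := (abs_le.1 (hu t u xb hn1 (by simpa using hη.le))).1
        have h4 := huΩ.2 t
        have h7 := min_le_right ε0 (r * ‖u - xb‖)
        rw [map_add, map_smul, smul_eq_mul]
        have h5 : 2 * r * ‖u - xb‖ / δ * (-δ) = -(2 * r * ‖u - xb‖) := by field_simp
        have h6 : 0 ≤ 2 * r * ‖u - xb‖ / δ := by positivity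
        have := mul_le_mul_of_nonneg_left h2 h6
        linarith) hs) (ha (min ε0 (r * ‖u - xb‖)) (lt_min hε0 hrp))
    rw [map_add, map_smul, smul_eq_mul] at h1
    have h2 : a (u - xb) ≤ γ / 2 * ‖u - xb‖ := by
      have h3 : 2 * r * ‖u - xb‖ / δ * a xt = (2 * r / δ * a xt) * ‖u - xb‖ := by ring
      have h4 : -(2 * r / δ * a xt) ≤ γ / 2 := by
        have : 0 ≤ 2 * r / δ := by positivity
        nlinarith [neg_abs_le (a xt)]
      nlinarith
    have h3 : q (dh (u - xb)) ≤ γ / 2 * ‖u - xb‖ := by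
      refine (le_abs_self _).trans ((q.le_opNorm _).trans ?_)
      calc ‖q‖ * ‖dh (u - xb)‖ ≤ ‖q‖ * (c * ‖u - xb‖) := by gcongr
        _ = (‖q‖ * c) * ‖u - xb‖ := by ring
        _ ≤ _ := by gcongr
    show a (u - xb) + q (dh (u - xb)) ≤ (0 + γ) * ‖u - xb‖
    linarith
  have hC : frechetNormal {x : X | h x = 0 ∧ ∀ t : T, g t x ≤ 0} xb ⊆
      limitingNormal {x : X | h x = 0 ∧ ∀ t : T, g t x ≤ 0} xb := fun p hp =>
    ⟨fun _ => 0, fun _ => xb, fun _ => p, fun _ => le_rfl, tendsto_const_nhds, fun _ => hxb,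
      tendsto_const_nhds, fun _ => hp, fun _ => tendsto_const_nhds⟩
  exact ⟨hA.antisymm (hB.trans hC), (hA.trans hB).antisymm hC⟩
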